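/- arXiv:1909.01180 — 4 statements merged into one kernel-verified Lean document; each statement's English description precedes it below -/
import Mathlib

section
/- Let G be a finite group, N a normal subgroup of G, and θ an irreducible complex character of N that is G-invariant (θ(gng⁻¹) = θ(n) for all g ∈ G, n ∈ N). Let p be a prime and P a normal subgroup of G containing N such that P/N is a normal Sylow p-subgroup of G/N, and suppose every Sylow subgroup of G/P is cyclic. Then either θ extends to an irreducible character of G (i.e. there is χ ∈ Irr(G) with χ restricted to N equal to θ), or every irreducible character χ of G lying over θ has degree divisible by p·θ(1). -/
open CategoryTheory

/-- `cd(G)`: the set of character degrees of `G`, i.e. the dimensions of the simple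
finite-dimensional complex representations of `G`. -/
def charDegrees (G : Type) [Group G] : Set ℕ :=
  { n | ∃ V : FDRep ℂ G, Simple V ∧ Module.finrank ℂ V = n }

/-- `ρ(G)`: the set of primes dividing some character degree of `G`. -/
def charPrimes (G : Type) [Group G] : Set ℕ :=
  { p | p.Prime ∧ ∃ n ∈ charDegrees G, p ∣ n }

/-- The character graph `Δ(G)`, on vertex set `ρ(G)`: two distinct primes `p`, `q`
are adjacent iff `p * q` divides some character degree of `G`. -/
def charGraph (G : Type) [Group G] : SimpleGraph (charPrimes G) where
  Adj p q := (p : ℕ) ≠ (q : ℕ) ∧ ∃ n ∈ charDegrees G, (p : ℕ) * (q : ℕ) ∣ n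
  symm := by
    constructor
    rintro p q ⟨h, n, hn, hd⟩
    exact ⟨fun e => h e.symm, n, hn, by rwa [mul_comm]⟩
  loopless := by constructor; rintro p ⟨h, -⟩; exact h rfl

/-- The solvable radical `R(G)` of `G`: the largest solvable normal subgroup of `G`
(realized as the join of all solvable normal subgroups). -/
def solvableRadical (G : Type*) [Group G] : Subgroup G :=
  ⨆ N : { N : Subgroup G // N.Normal ∧ IsSolvable ↥N }, (N : Subgroup G)

instance solvableRadical_normal (G : Type*) [Group G] : (solvableRadical G).Normal := by
  constructor
  intro n hn g
  refine Subgroup.iSup_induction (C := fun x => g * x * g⁻¹ ∈ solvableRadical G)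
    (fun N : { N : Subgroup G // N.Normal ∧ IsSolvable ↥N } => (N : Subgroup G)) hn ?_ ?_ ?_
  · intro N x hx
    exact Subgroup.mem_iSup_of_mem N (N.2.1.conj_mem x hx g)
  · simpa using Subgroup.one_mem _
  · intro x y hx hy
    have h : g * (x * y) * g⁻¹ = (g * x * g⁻¹) * (g * y * g⁻¹) := by group
    rw [h]; exact Subgroup.mul_mem _ hx hy

/-- `PSL₂(F)`: the special linear group `SL₂(F)` modulo its center. -/
abbrev PSL2 (F : Type) [Field F] :=
  Matrix.SpecialLinearGroup (Fin 2) F ⧸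
    Subgroup.center (Matrix.SpecialLinearGroup (Fin 2) F)

/-- The join `Γ ⋆ Δ` of two simple graphs: the disjoint union together with all
edges between the two vertex sets. -/
def graphJoin {α β : Type*} (G : SimpleGraph α) (H : SimpleGraph β) :
    SimpleGraph (α ⊕ β) :=
  (G ⊕g H) ⊔
    { Adj := fun u v => u.isLeft ≠ v.isLeft
      symm := ⟨fun _ _ h => h.symm⟩
      loopless := ⟨fun _ h => h rfl⟩ }

/-- The image of a subgroup `M` of `G` in `G/R(G)`; when `R(G) ≤ M` this is `M/R(G)`. -/
def radicalQuotImage {G : Type*} [Group G] (M : Subgroup G) :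
    Subgroup (G ⧸ solvableRadical G) :=
  M.map (QuotientGroup.mk' (solvableRadical G))

/-- Restriction of a finite-dimensional complex representation of `G`
to a subgroup `N` of `G`. -/
noncomputable def fdRes {G : Type} [Group G] (N : Subgroup G) (W : FDRep ℂ G) :
    FDRep ℂ ↥N :=
  FDRep.of (W.ρ.comp N.subtype)


set_option linter.style.haveILetI false

lemma cyc_split {E A Q : Type} [Group E] [CommGroup A] [Group Q] [IsCyclic Q]
    (hA : ∀ n : ℕ, n ≠ 0 → Function.Surjective fun a : A => a ^ n)
    (ι : A →* E) (hι : Function.Injective ι) (hc : ∀ a e, ι a * e = e * ι a)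
    (π : E →* Q) (hk : ∀ e, π e = 1 → ∃ a, ι a = e) :
    ∃ r : E →* A, ∀ a, r (ι a) = a := by
  have hcomm : ∀ a b : E, a * b = b * a := by
    intro a b
    refine commutative_of_cyclic_center_quotient π ?_ a b
    intro e he
    obtain ⟨a, rfl⟩ := hk e he
    rw [Subgroup.mem_center_iff]
    intro g
    exact (hc a g).symm
  letI : CommGroup E := { (inferInstance : Group E) with mul_comm := hcomm }
  letI : RootableBy A ℕ := rootableByOfPowLeftSurj A ℕ (fun {n} hn => hA n hn)
  letI : RootableBy A ℤ := Group.rootableByIntOfRootableByNat A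
  letI : DivisibleBy (Additive A) ℤ :=
    { div := fun a n => Additive.ofMul (RootableBy.root (Additive.toMul a) n)
      div_zero := fun a => by
        exact congrArg Additive.ofMul (RootableBy.root_zero (α := ℤ) (Additive.toMul a))
      div_cancel := fun {n} a hn => by
        exact congrArg Additive.ofMul (RootableBy.root_cancel (α := ℤ) (Additive.toMul a) hn) }
  have hB := Module.Baer.of_divisible (Additive A)
  obtain ⟨h, hh⟩ := hB.extension_property (MonoidHom.toAdditive ι).toIntLinearMap hι LinearMap.id
  refine ⟨MonoidHom.toAdditive.symm h.toAddMonoidHom, fun a => ?_⟩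
  exact congrArg Additive.toMul (LinearMap.congr_fun hh (Additive.ofMul a))

lemma main_split {E A Q : Type} [Group E] [CommGroup A] [Group Q] [Finite Q]
    (hA : ∀ n : ℕ, n ≠ 0 → Function.Surjective fun a : A => a ^ n)
    (ι : A →* E) (hι : Function.Injective ι) (hc : ∀ a e, ι a * e = e * ι a)
    (π : E →* Q) (hπ : Function.Surjective π) (hk : ∀ e, π e = 1 ↔ ∃ a, ι a = e)
    (p : ℕ)
    (hS : ∀ q : ℕ, q.Prime → q ≠ p → ∀ S : Sylow q Q, IsCyclic (S : Subgroup Q))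
    (δ : E →* A) (d : ℤ) (hδ : ∀ a, δ (ι a) = a ^ d) (hd : ¬ (p : ℤ) ∣ d) :
    ∃ r : E →* A, ∀ a, r (ι a) = a := by
  let S : AddSubgroup ℤ :=
    { carrier := {k | ∃ δ : E →* A, ∀ a, δ (ι a) = a ^ k}
      zero_mem' := ⟨1, fun a => by simp⟩
      add_mem' := by
        rintro k l ⟨f, hf⟩ ⟨g, hg⟩
        exact ⟨f * g, fun a => by simp [hf, hg, zpow_add]⟩
      neg_mem' := by
        rintro k ⟨f, hf⟩
        exact ⟨f⁻¹, fun a => by simp [hf]⟩ }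
  have key : ∀ q : ℕ, q.Prime → ∃ k ∈ S, ¬ (q : ℤ) ∣ k := by
    intro q hq
    by_cases hqp : q = p
    · subst hqp
      exact ⟨d, ⟨δ, hδ⟩, hd⟩
    haveI : Fact q.Prime := ⟨hq⟩
    let T : Sylow q Q := default
    haveI := hS q hq hqp T
    let H : Subgroup E := (T : Subgroup Q).comap π
    have hind : H.index = (T : Subgroup Q).index := Subgroup.index_comap_of_surjective _ hπ
    have hιH : ∀ a, ι a ∈ H := fun a => by
      have : π (ι a) = 1 := (hk _).2 ⟨a, rfl⟩
      show π (ι a) ∈ (T : Subgroup Q)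
      rw [this]; exact one_mem _
    haveI : H.FiniteIndex := ⟨by rw [hind]; exact Subgroup.index_ne_zero_of_finite⟩
    obtain ⟨r, hr⟩ := cyc_split (E := H) (Q := (T : Subgroup Q)) hA (ι.codRestrict H hιH)
      (fun a b h => hι (congrArg Subtype.val h))
      (fun a e => Subtype.ext (hc a e))
      ((π.comp H.subtype).codRestrict (T : Subgroup Q) (fun h => h.2))
      (fun e he => by
        obtain ⟨a, ha⟩ := (hk e).1 (congrArg Subtype.val he)
        exact ⟨a, Subtype.ext ha⟩)
    refine ⟨H.index, ⟨r.transfer, fun a => ?_⟩, ?_⟩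
    · have h1 := MonoidHom.transfer_eq_pow r (ι a) (fun k g₀ _ => by
        rw [← map_pow, mul_assoc, hc, inv_mul_cancel_left])
      rw [h1, zpow_natCast]
      have h2 := hr (a ^ H.index)
      rw [← h2]
      congr 1
      exact Subtype.ext (map_pow ι a _).symm
    · rw [hind]
      exact_mod_cast T.not_dvd_index
  obtain ⟨m, hm⟩ := Int.subgroup_cyclic S
  have h1 : m.natAbs = 1 := by
    by_contra hne
    obtain ⟨q, hq, hqm⟩ := Nat.exists_prime_and_dvd hne
    obtain ⟨k, hkS, hk⟩ := key q hq
    rw [hm, AddSubgroup.mem_closure_singleton] at hkS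
    obtain ⟨z, rfl⟩ := hkS
    exact hk (Dvd.dvd.mul_left (Int.natCast_dvd.2 hqm) z)
  have : (1 : ℤ) ∈ S := by
    rw [hm, AddSubgroup.mem_closure_singleton]
    rcases Int.natAbs_eq m with h | h <;> rw [h1] at h
    · exact ⟨1, by simp [h]⟩
    · exact ⟨-1, by simp [h]⟩
  obtain ⟨r, hr⟩ := this
  exact ⟨r, fun a => by simpa using hr a⟩

lemma sylow_cyc (G : Type) [Group G] [Finite G] (N P : Subgroup G)
    [hN : N.Normal] [hP : P.Normal] (hNP : N ≤ P)
    (p : ℕ) (hp : p.Prime)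
    (hPgrp : IsPGroup p ↥(P.map (QuotientGroup.mk' N)))
    (hcyc : ∀ q : ℕ, q.Prime → ∀ Q : Sylow q (G ⧸ P), IsCyclic ↥(Q : Subgroup (G ⧸ P)))
    (q : ℕ) (hq : q.Prime) (hqp : q ≠ p) (S : Sylow q (G ⧸ N)) :
    IsCyclic (S : Subgroup (G ⧸ N)) := by
  haveI : Fact q.Prime := ⟨hq⟩
  haveI : Fact p.Prime := ⟨hp⟩
  let f : G ⧸ N →* G ⧸ P := QuotientGroup.map N P (MonoidHom.id G) (by simpa using hNP)
  have hdis : Disjoint (S : Subgroup (G ⧸ N)) (P.map (QuotientGroup.mk' N)) :=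
    IsPGroup.disjoint_of_ne q p hqp _ _ S.isPGroup' hPgrp
  obtain ⟨Q, hQ⟩ := (S.isPGroup'.map f).exists_le_sylow
  haveI := hcyc q hq Q
  refine isCyclic_of_injective (G' := (Q : Subgroup (G ⧸ P)))
    ((f.comp (S : Subgroup (G ⧸ N)).subtype).codRestrict (Q : Subgroup (G ⧸ P))
      (fun x => hQ ⟨x, x.2, rfl⟩)) ?_
  rw [injective_iff_map_eq_one]
  rintro ⟨x, hx⟩ h
  have h1 : f x = 1 := congrArg Subtype.val h
  obtain ⟨g, rfl⟩ := QuotientGroup.mk_surjective x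
  have h2 : g ∈ P := (QuotientGroup.eq_one_iff g).1 h1
  exact Subtype.ext (Subgroup.disjoint_def.1 hdis hx ⟨g, h2, rfl⟩)


def SchurProp {H X : Type} [Group H] [AddCommGroup X] [Module ℂ X]
    (ρ : Representation ℂ H X) : Prop :=
  ∀ f : Module.End ℂ X, (∀ h, f * ρ h = ρ h * f) → ∃ c : ℂ, f = c • 1

lemma twist_comm {H X : Type} [Group H] [Fintype H] [AddCommGroup X] [Module ℂ X]
    (τ : Representation ℂ H X) (χ : H → ℂ) (φ : H ≃* H) (hχ : ∀ h, χ (φ h) = χ h)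
    (S : Module.End ℂ X) (hS : ∀ h, S * τ h = τ (φ h) * S) :
    S * (∑ h, χ h⁻¹ • τ h) = (∑ h, χ h⁻¹ • τ h) * S := by
  rw [Finset.mul_sum, Finset.sum_mul, ← Equiv.sum_comp φ.toEquiv (fun h => χ h⁻¹ • τ h * S)]
  refine Finset.sum_congr rfl fun h _ => ?_
  have h1 : χ (φ h)⁻¹ = χ h⁻¹ := by rw [← map_inv, hχ]
  simp only [MulEquiv.toEquiv_eq_coe, MulEquiv.coe_toEquiv]
  rw [h1, mul_smul_comm, smul_mul_assoc, hS]

lemma rep_dim {G X U : Type} [Group G] [Finite G] (N : Subgroup G) [N.Normal]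
    [AddCommGroup X] [Module ℂ X] [FiniteDimensional ℂ X]
    [AddCommGroup U] [Module ℂ U] [FiniteDimensional ℂ U]
    (ρ : Representation ℂ N X) (σ : Representation ℂ G U)
    (hρ : SchurProp ρ) (hσ : SchurProp σ)
    (hinv : ∀ (g : G) (n : N), ρ.character (MulAut.conjNormal g n) = ρ.character n)
    (f : Representation.IntertwiningMap ρ (σ.comp N.subtype)) (hf : f ≠ 0) :
    Module.finrank ℂ U = Module.finrank ℂ X *
      Module.finrank ℂ (Representation.IntertwiningMap ρ (σ.comp N.subtype)) := by
  classical
  haveI : Fintype N := Fintype.ofFinite _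
  have hcard : (Nat.card N : ℂ) ≠ 0 := Nat.cast_ne_zero.2 Nat.card_pos.ne'
  haveI : Invertible (Nat.card N : ℂ) := invertibleOfNonzero hcard
  let σ' : Representation ℂ N U := σ.comp N.subtype
  have eσ := Representation.card_inv_mul_sum_char_mul_char_eq_finrank ρ σ'
  have eρ := Representation.card_inv_mul_sum_char_mul_char_eq_finrank ρ ρ
  obtain ⟨a, ha⟩ := hρ (∑ n, ρ.character n⁻¹ • ρ n) (fun h =>
    (twist_comm ρ ρ.character (MulAut.conj h)
      (fun n => by simp [MulAut.conj_apply]) (ρ h)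
      (fun n => by rw [← map_mul, ← map_mul]; simp [MulAut.conj_apply])).symm)
  obtain ⟨b, hb⟩ := hσ (∑ n, ρ.character n⁻¹ • σ' n) (fun h =>
    (twist_comm σ' ρ.character (MulAut.conjNormal h)
      (fun n => hinv h n) (σ h)
      (fun n => by
        show σ h * σ n = σ (MulAut.conjNormal h n : N) * σ h
        rw [← map_mul, ← map_mul]; simp)).symm)
  obtain ⟨x, hx⟩ : ∃ x, f x ≠ 0 := by
    by_contra hcon
    push Not at hcon
    exact hf (Representation.IntertwiningMap.ext (LinearMap.ext hcon))
  have hx0 : x ≠ 0 := by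
    rintro rfl
    exact hx (map_zero f.toLinearMap)
  have hab : b = a := by
    have h1 : f.toLinearMap ((∑ n, ρ.character n⁻¹ • ρ n) x) =
        (∑ n, ρ.character n⁻¹ • σ' n) (f.toLinearMap x) := by
      simp only [LinearMap.sum_apply, map_sum, LinearMap.smul_apply, map_smul]
      refine Finset.sum_congr rfl fun n _ => ?_
      congr 1
      exact LinearMap.congr_fun (f.isIntertwining' n) x
    rw [ha, hb] at h1
    simp only [LinearMap.smul_apply, Module.End.one_apply, map_smul] at h1
    exact (smul_left_injective ℂ hx h1).symm
  subst hab
  have hone : Module.finrank ℂ (Representation.IntertwiningMap ρ ρ) = 1 := by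
    refine finrank_eq_one (Representation.IntertwiningMap.id ρ) ?_ ?_
    · intro h
      apply hx0
      exact congrArg (fun k : Representation.IntertwiningMap ρ ρ => k x) h
    · intro k
      obtain ⟨c, hc⟩ := hρ k.toLinearMap (fun h => k.isIntertwining' h)
      exact ⟨c, Representation.IntertwiningMap.ext hc.symm⟩
  have tr : ∀ {Y : Type} [AddCommGroup Y] [Module ℂ Y] [FiniteDimensional ℂ Y]
      (τ : Representation ℂ N Y), (∑ n, ρ.character n⁻¹ • τ n) = b • 1 →
      ∑ n, τ.character n * ρ.character n⁻¹ = b * Module.finrank ℂ Y := by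
    intro Y _ _ _ τ h
    have := congrArg (LinearMap.trace ℂ Y) h
    simp only [map_sum, map_smul, smul_eq_mul, LinearMap.trace_one] at this
    rw [← this]
    exact Finset.sum_congr rfl fun n _ => mul_comm _ _
  rw [tr ρ ha, hone] at eρ
  rw [tr σ' hb] at eσ
  rw [inv_mul_eq_iff_eq_mul₀ hcard] at eρ eσ
  have hb0 : b ≠ 0 := by
    rintro rfl
    rw [zero_mul, Nat.cast_one, mul_one] at eρ
    exact hcard eρ.symm
  have : (Module.finrank ℂ U : ℂ) = (Module.finrank ℂ X : ℂ) *
      (Module.finrank ℂ (Representation.IntertwiningMap ρ σ') : ℂ) := by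
    apply mul_left_cancel₀ hb0
    rw [eσ, ← mul_assoc, eρ]
    simp
  exact_mod_cast this

def Gam {G X : Type} [Group G] {N : Subgroup G} [N.Normal] [AddCommGroup X] [Module ℂ X]
    (ρ : Representation ℂ N X) : Subgroup (G × (Module.End ℂ X)ˣ) where
  carrier := {x | ∀ n : N, (x.2 : Module.End ℂ X) * ρ n = ρ (MulAut.conjNormal x.1 n) * x.2}
  one_mem' := fun n => by simp
  mul_mem' := by
    intro x y hx hy n
    simp only [Prod.snd_mul, Prod.fst_mul, Units.val_mul, map_mul, MulAut.mul_apply]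
    rw [mul_assoc, hy, ← mul_assoc, hx, mul_assoc]
  inv_mem' := by
    intro x hx n
    have := hx (MulAut.conjNormal x.1⁻¹ n)
    rw [← MulAut.mul_apply, ← map_mul, mul_inv_cancel, map_one, MulAut.one_apply] at this
    simp only [Prod.snd_inv, Prod.fst_inv]
    rw [Units.inv_mul_eq_iff_eq_mul, ← mul_assoc, this, mul_assoc, Units.mul_inv, mul_one]

/-- the action of `Gam ρ` on the multiplicity space -/
noncomputable def actM {G X U : Type} [Group G] {N : Subgroup G} [N.Normal]
    [AddCommGroup X] [Module ℂ X] [AddCommGroup U] [Module ℂ U]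
    (ρ : Representation ℂ N X) (σ : Representation ℂ G U) :
    Gam ρ →* Module.End ℂ (Representation.IntertwiningMap ρ (σ.comp N.subtype)) where
  toFun x :=
    { toFun := fun f => ⟨σ x.1.1 ∘ₗ f.toLinearMap ∘ₗ ((x.1.2⁻¹ : (Module.End ℂ X)ˣ) : Module.End ℂ X),
        fun n => by
          have h1 := (x⁻¹).2 n
          have h2 := f.isIntertwining' (MulAut.conjNormal (x.1.1)⁻¹ n)
          ext v
          have h1' := LinearMap.congr_fun h1 v
          have h2' := LinearMap.congr_fun h2 (((x.1.2⁻¹ : (Module.End ℂ X)ˣ) : Module.End ℂ X) v)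
          simp only [Subgroup.coe_inv, Prod.snd_inv, Prod.fst_inv, Module.End.mul_apply] at h1'
          simp only [LinearMap.comp_apply] at h2' ⊢
          rw [h1', h2']
          show σ _ (σ _ _) = σ _ (σ _ _)
          rw [← Module.End.mul_apply, ← Module.End.mul_apply, ← map_mul, ← map_mul]
          congr 2
          simp [mul_assoc]⟩
      map_add' := fun f g => by
        ext v; simp
      map_smul' := fun c f => by
        ext v; simp }
  map_one' := by
    ext f v; simp
  map_mul' x y := by
    ext f v; simp

lemma actM_apply {G X U : Type} [Group G] {N : Subgroup G} [N.Normal]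
    [AddCommGroup X] [Module ℂ X] [AddCommGroup U] [Module ℂ U]
    (ρ : Representation ℂ N X) (σ : Representation ℂ G U) (x : Gam ρ) 
    (f : Representation.IntertwiningMap ρ (σ.comp N.subtype)) (v : X) :
    actM ρ σ x f v = σ x.1.1 (f (((x.1.2⁻¹ : (Module.End ℂ X)ˣ) : Module.End ℂ X) v)) := rfl

def jN {G X : Type} [Group G] {N : Subgroup G} [N.Normal] [AddCommGroup X] [Module ℂ X]
    (ρ : Representation ℂ N X) : N →* Gam ρ where
  toFun n := ⟨((n : G), MonoidHom.toHomUnits ρ n), fun m => by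
    simp only [MonoidHom.coe_toHomUnits]
    rw [← map_mul, ← map_mul]
    congr 1
    ext; simp⟩
  map_one' := by ext <;> simp
  map_mul' a b := by ext <;> simp

def iC {G X : Type} [Group G] {N : Subgroup G} [N.Normal] [AddCommGroup X] [Module ℂ X]
    (ρ : Representation ℂ N X) : ℂˣ →* Gam ρ where
  toFun c := ⟨(1, Units.map (algebraMap ℂ (Module.End ℂ X)).toMonoidHom c), fun m => by
    simp [Algebra.commutes]⟩
  map_one' := by ext <;> simp
  map_mul' a b := by ext <;> simp

lemma unit_scalar {X : Type} [AddCommGroup X] [Module ℂ X] [Nontrivial X]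
    (T : (Module.End ℂ X)ˣ) (c : ℂ) (h : (T : Module.End ℂ X) = c • 1) :
    ∃ d : ℂˣ, Units.map (algebraMap ℂ (Module.End ℂ X)).toMonoidHom d = T := by
  have hc : c ≠ 0 := by
    rintro rfl
    rw [zero_smul] at h
    exact T.ne_zero h
  refine ⟨Units.mk0 c hc, Units.ext ?_⟩
  rw [h]
  simp [Algebra.algebraMap_eq_smul_one]

theorem rep_main {G X U : Type} [Group G] [Finite G] (N : Subgroup G) [N.Normal]
    [AddCommGroup X] [Module ℂ X] [FiniteDimensional ℂ X] [Nontrivial X]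
    [AddCommGroup U] [Module ℂ U] [FiniteDimensional ℂ U]
    (ρ : Representation ℂ N X) (σ : Representation ℂ G U)
    (hρ : SchurProp ρ)
    (hT : ∀ g : G, ∃ T : (Module.End ℂ X)ˣ, ∀ n : N,
      (T : Module.End ℂ X) * ρ n = ρ (MulAut.conjNormal g n) * T)
    (p : ℕ)
    (hS : ∀ q : ℕ, q.Prime → q ≠ p → ∀ S : Sylow q (G ⧸ N), IsCyclic (S : Subgroup (G ⧸ N)))
    (hd : ¬ p ∣ Module.finrank ℂ (Representation.IntertwiningMap ρ (σ.comp N.subtype))) :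
    ∃ τ : Representation ℂ G X, ∀ n : N, τ n = ρ n := by
  let π₀ : Gam ρ →* G := (MonoidHom.fst G _).comp (Gam ρ).subtype
  have hπ₀ : Function.Surjective π₀ := fun g => by
    obtain ⟨T, hT⟩ := hT g
    exact ⟨⟨(g, T), hT⟩, rfl⟩
  have hker : ∀ x : Gam ρ, π₀ x = 1 → ∃ c, iC ρ c = x := by
    rintro ⟨⟨g, T⟩, hx⟩ h
    have hg : g = 1 := h
    subst hg
    obtain ⟨c, hc⟩ := hρ (T : Module.End ℂ X) (fun n => by simpa using hx n)
    obtain ⟨d, hd⟩ := unit_scalar T c hc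
    exact ⟨d, Subtype.ext (Prod.ext rfl hd)⟩
  have hcent : ∀ c (x : Gam ρ), iC ρ c * x = x * iC ρ c := by
    intro c x
    refine Subtype.ext (Prod.ext ?_ (Units.ext ?_))
    · simp [iC]
    · exact Algebra.commutes _ _
  haveI hnorm : (jN ρ).range.Normal := by
    constructor
    rintro _ ⟨n, rfl⟩ x
    refine ⟨MulAut.conjNormal x.1.1 n, ?_⟩
    rw [eq_mul_inv_iff_mul_eq]
    refine Subtype.ext (Prod.ext ?_ (Units.ext ?_))
    · simp [jN]
    · exact (x.2 n).symm
  let E := Gam ρ ⧸ (jN ρ).range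
  let ι : ℂˣ →* E := (QuotientGroup.mk' (jN ρ).range).comp (iC ρ)
  have hι : Function.Injective ι := by
    rw [injective_iff_map_eq_one]
    intro c hc
    obtain ⟨n, hn⟩ := (QuotientGroup.eq_one_iff (iC ρ c)).1 hc
    have h1 : n = 1 := Subtype.ext (congrArg (fun y : Gam ρ => y.1.1) hn)
    subst h1
    rw [map_one] at hn
    have h2 := congrArg (fun y : Gam ρ => (y.1.2 : Module.End ℂ X)) hn
    have h3 : algebraMap ℂ (Module.End ℂ X) 1 = algebraMap ℂ (Module.End ℂ X) c := by
      rw [map_one]; exact h2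
    exact Units.ext ((algebraMap ℂ (Module.End ℂ X)).injective h3).symm
  let π : E →* G ⧸ N := QuotientGroup.map (jN ρ).range N π₀ (by
    rintro _ ⟨n, rfl⟩
    exact n.2)
  have hπ : Function.Surjective π := by
    intro y
    obtain ⟨g, rfl⟩ := QuotientGroup.mk_surjective y
    obtain ⟨x, rfl⟩ := hπ₀ g
    exact ⟨(x : E), rfl⟩
  have hA : ∀ n : ℕ, n ≠ 0 → Function.Surjective fun a : ℂˣ => a ^ n := by
    intro n hn a
    obtain ⟨z, hz⟩ := IsAlgClosed.exists_pow_nat_eq (a : ℂ) (Nat.pos_of_ne_zero hn)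
    have hz0 : z ≠ 0 := by
      rintro rfl
      rw [zero_pow hn] at hz
      exact a.ne_zero hz.symm
    exact ⟨Units.mk0 z hz0, Units.ext hz⟩
  have hk : ∀ e, π e = 1 ↔ ∃ a, ι a = e := by
    intro e
    constructor
    · intro he
      obtain ⟨x, rfl⟩ := QuotientGroup.mk_surjective e
      have hx : π₀ x ∈ N := (QuotientGroup.eq_one_iff _).1 he
      obtain ⟨c, hc⟩ := hker (x * (jN ρ ⟨π₀ x, hx⟩)⁻¹) (by
        rw [map_mul, map_inv]
        exact mul_inv_cancel (π₀ x))
      refine ⟨c, ?_⟩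
      show ((iC ρ c : Gam ρ) : E) = x
      rw [hc, QuotientGroup.eq]
      refine ⟨MulAut.conjNormal 1 ⟨π₀ x, hx⟩, ?_⟩
      simp
    · rintro ⟨a, rfl⟩
      show ((π₀ (iC ρ a) : G) : G ⧸ N) = 1
      have : π₀ (iC ρ a) = 1 := rfl
      rw [this]; rfl
  let δ₀ : Gam ρ →* ℂˣ := MonoidHom.toHomUnits ((LinearMap.det).comp (actM ρ σ))
  have hδj : ∀ n, δ₀ (jN ρ n) = 1 := by
    intro n
    have : actM ρ σ (jN ρ n) = 1 := by
      ext f v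
      show σ n (f (((((jN ρ n).1.2)⁻¹ : (Module.End ℂ X)ˣ) : Module.End ℂ X) v)) = f v
      have h1 : ((((jN ρ n).1.2)⁻¹ : (Module.End ℂ X)ˣ) : Module.End ℂ X) = ρ n⁻¹ := by
        show ((((MonoidHom.toHomUnits ρ n))⁻¹ : (Module.End ℂ X)ˣ) : Module.End ℂ X) = ρ n⁻¹
        rw [← map_inv, MonoidHom.coe_toHomUnits]
      have h2 : f (ρ n⁻¹ v) = σ (n⁻¹ : N) (f v) := LinearMap.congr_fun (f.isIntertwining' n⁻¹) v
      rw [h1, h2, ← Module.End.mul_apply, ← map_mul]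
      simp
    refine Units.ext ?_
    show LinearMap.det (actM ρ σ (jN ρ n)) = 1
    rw [this, map_one]
  have hδi : ∀ c, δ₀ (iC ρ c) = c ^ (-(Module.finrank ℂ (Representation.IntertwiningMap ρ (σ.comp N.subtype)) : ℤ)) := by
    intro c
    have : actM ρ σ (iC ρ c) = ((c⁻¹ : ℂˣ) : ℂ) • 1 := by
      ext f v
      show σ 1 (f ((((Units.map (algebraMap ℂ (Module.End ℂ X)).toMonoidHom c)⁻¹ :
        (Module.End ℂ X)ˣ) : Module.End ℂ X) v)) = ((c⁻¹ : ℂˣ) : ℂ) • f v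
      rw [← map_inv, map_one, Module.End.one_apply]
      show f.toLinearMap (algebraMap ℂ (Module.End ℂ X) ((c⁻¹ : ℂˣ) : ℂ) v) = _
      rw [Module.algebraMap_end_apply, map_smul]
      rfl
    refine Units.ext ?_
    show LinearMap.det (actM ρ σ (iC ρ c)) = _
    rw [this, LinearMap.det_smul, map_one]
    simp
  let δ : E →* ℂˣ := QuotientGroup.lift (jN ρ).range δ₀ (by
    rintro _ ⟨n, rfl⟩
    exact hδj n)
  obtain ⟨r, hr⟩ := main_split (E := E) hA ι hι (fun a e => by
      obtain ⟨x, rfl⟩ := QuotientGroup.mk_surjective e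
      show ((iC ρ a * x : Gam ρ) : E) = ((x * iC ρ a : Gam ρ) : E)
      rw [hcent]) π hπ hk p hS δ _ (fun a => hδi a) (by
      rw [dvd_neg]; exact_mod_cast hd)
  let t : Gam ρ →* Module.End ℂ X :=
    { toFun := fun x => ((r (x : E))⁻¹ : ℂˣ).val • (x.1.2 : Module.End ℂ X)
      map_one' := by simp
      map_mul' := fun x y => by
        simp [smul_smul, mul_comm] }
  have ht : π₀.ker ≤ t.ker := by
    intro x hx
    obtain ⟨c, rfl⟩ := hker x hx
    show ((r (ι c))⁻¹ : ℂˣ).val • (algebraMap ℂ (Module.End ℂ X) c) = 1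
    rw [hr, Algebra.algebraMap_eq_smul_one, smul_smul]
    simp
  choose s hs using hπ₀
  have htt : ∀ x y, π₀ x = π₀ y → t x = t y := by
    intro x y h
    have h1 : t (x * y⁻¹) = 1 := ht (by
      show π₀ _ = 1
      rw [map_mul, map_inv, h, mul_inv_cancel])
    have : x = (x * y⁻¹) * y := by group
    rw [this, map_mul, h1, one_mul]
  refine ⟨⟨⟨fun g => t (s g), ?_⟩, ?_⟩, ?_⟩
  · rw [← map_one t]
    exact htt _ _ (by rw [hs, map_one])
  · intro a b
    show t _ = t _ * t _
    rw [← map_mul]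
    exact htt _ _ (by rw [map_mul, hs, hs, hs])
  · intro n
    show t (s n) = _
    rw [htt (s n) (jN ρ n) (by rw [hs]; rfl)]
    show ((r ((jN ρ n : Gam ρ) : E))⁻¹ : ℂˣ).val • ρ n = ρ n
    have : ((jN ρ n : Gam ρ) : E) = 1 := (QuotientGroup.eq_one_iff _).2 ⟨n, rfl⟩
    rw [this]
    simp

lemma schur_of_simple {H : Type} [Group H] (V : FDRep ℂ H) [Simple V] : SchurProp V.ρ := by
  intro f hf
  let F : V ⟶ V := ⟨InducedCategory.homMk (ModuleCat.ofHom f), fun h => by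
    ext1
    exact hf h⟩
  have h1 := finrank_endomorphism_simple_eq_one ℂ V
  obtain ⟨c, hc⟩ := (finrank_eq_one_iff_of_nonzero' (𝟙 V) (id_nonzero V)).1 h1 F
  refine ⟨c, ?_⟩
  exact (congrArg (fun k : V ⟶ V => k.hom.hom.hom) hc).symm

lemma simple_of_schur {H : Type} [Group H] [Finite H] (V : FDRep ℂ H) [Nontrivial V]
    (h : SchurProp V.ρ) : Simple V := by
  rw [FDRep.simple_iff_end_is_rank_one]
  refine finrank_eq_one (𝟙 V) ?_ ?_
  · intro h0
    obtain ⟨v, hv⟩ := exists_ne (0 : V)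
    apply hv
    exact LinearMap.congr_fun (congrArg (fun k : V ⟶ V => k.hom.hom.hom) h0) v
  · intro F
    obtain ⟨c, hc⟩ := h F.hom.hom.hom (fun g => congrArg (fun k => k.hom.hom) (F.comm g))
    refine ⟨c, ?_⟩
    ext v
    exact (LinearMap.congr_fun hc v).symm

lemma nontrivial_of_simple {H : Type} [Group H] (V : FDRep ℂ H) [Simple V] : Nontrivial V := by
  by_contra hn
  rw [not_nontrivial_iff_subsingleton] at hn
  apply id_nonzero V
  ext v
  exact Subsingleton.elim (α := V) _ _

lemma exists_T {G : Type} [Group G] [Finite G] (N : Subgroup G) [hN : N.Normal]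
    (V : FDRep ℂ N) [Simple V]
    (hinv : ∀ (g : G) (n : N), V.character (MulAut.conjNormal g n) = V.character n) (g : G) :
    ∃ T : (Module.End ℂ V)ˣ, ∀ n : N,
      (T : Module.End ℂ V) * V.ρ n = V.ρ (MulAut.conjNormal g n) * T := by
  classical
  haveI : Fintype N := Fintype.ofFinite _
  have hcard : (Nat.card N : ℂ) ≠ 0 := Nat.cast_ne_zero.2 Nat.card_pos.ne'
  haveI : Invertible (Nat.card N : ℂ) := invertibleOfNonzero hcard
  let V' : FDRep ℂ N := FDRep.of (V.ρ.comp (MulAut.conjNormal g : N ≃* N).toMonoidHom)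
  have hch : V'.character = V.character := funext fun n => hinv g n
  haveI : Simple V' := by
    have := (FDRep.simple_iff_char_is_norm_one V).1 inferInstance
    rw [← hch] at this
    exact (FDRep.simple_iff_char_is_norm_one V').2 this
  have h1 := FDRep.char_orthonormal V V'
  have h2 := FDRep.char_orthonormal V V
  rw [hch, h2, if_pos ⟨Iso.refl V⟩] at h1
  have h3 : Nonempty (V ≅ V') := by
    by_contra hcon
    rw [if_neg hcon] at h1
    exact one_ne_zero h1
  obtain ⟨i⟩ := h3
  let e : V ≃ₗ[ℂ] V := (FDRep.isoToLinearEquiv i : V ≃ₗ[ℂ] V')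
  refine ⟨(LinearMap.GeneralLinearGroup.generalLinearEquiv ℂ V).symm e, fun n => ?_⟩
  have h4 : V.ρ (MulAut.conjNormal g n) = e.conj (V.ρ n) := FDRep.Iso.conj_ρ i n
  rw [h4]
  refine LinearMap.ext fun v => ?_
  show e _ = e.conj (V.ρ n) (e v)
  rw [LinearEquiv.conj_apply_apply, LinearEquiv.symm_apply_apply]

theorem stmt4 (G : Type) [Group G] [Finite G] (N P : Subgroup G)
    [hN : N.Normal] [hP : P.Normal] (hNP : N ≤ P)
    (p : ℕ) (hp : p.Prime)
    (V : FDRep ℂ ↥N) (hV : Simple V)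
    (hinv : ∀ (g : G) (n : N),
      V.character ⟨g * (n : G) * g⁻¹, hN.conj_mem (n : G) n.2 g⟩ = V.character n)
    (hPgrp : IsPGroup p ↥(P.map (QuotientGroup.mk' N)))
    (hPsyl : ¬ p ∣ (P.map (QuotientGroup.mk' N)).index)
    (hcyc : ∀ q : ℕ, q.Prime → ∀ Q : Sylow q (G ⧸ P), IsCyclic ↥(Q : Subgroup (G ⧸ P))) :
    (∃ W : FDRep ℂ G, Simple W ∧ Nonempty (fdRes N W ≅ V)) ∨
    (∀ W : FDRep ℂ G, Simple W → (∃ f : V ⟶ fdRes N W, f ≠ 0) →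
      p * Module.finrank ℂ V ∣ Module.finrank ℂ W) := by
  have hinv' : ∀ (g : G) (n : N), V.character (MulAut.conjNormal g n) = V.character n :=
    fun g n => hinv g n
  rw [or_iff_not_imp_right]
  intro hcon
  push Not at hcon
  obtain ⟨W, hW, ⟨f, hf⟩, hdvd⟩ := hcon
  haveI := nontrivial_of_simple V
  have hρ := schur_of_simple V
  let f' : Representation.IntertwiningMap V.ρ (MonoidHom.comp W.ρ N.subtype) :=
    ⟨f.hom.hom.hom, fun n => congrArg (fun k => k.hom.hom) (f.comm n)⟩
  have hf' : f' ≠ 0 := by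
    intro h0
    apply hf
    ext v
    exact LinearMap.congr_fun (congrArg (fun k => k.toLinearMap) h0) v
  have hdim := rep_dim N V.ρ W.ρ hρ (schur_of_simple W) hinv' f' hf'
  obtain ⟨τ, hτ⟩ := rep_main N V.ρ W.ρ hρ (exists_T N V hinv') p
    (sylow_cyc G N P hNP p hp hPgrp hcyc) (by
      intro h
      apply hdvd
      rw [hdim, mul_comm]
      exact mul_dvd_mul_left _ h)
  refine ⟨FDRep.of τ, ?_, ⟨?_⟩⟩
  · haveI : Nontrivial (FDRep.of τ) := inferInstanceAs (Nontrivial V)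
    apply simple_of_schur
    intro k hk
    exact hρ k (fun n => by rw [← hτ n]; exact hk n)
  · refine Action.mkIso (Iso.refl _) (fun n => ?_)
    ext v
    exact LinearMap.congr_fun (hτ n) v
end

section
/- Let f be a positive integer such that 2^f − 1 has exactly two distinct prime divisors and 2^f + 1 has exactly two distinct prime divisors. Then f is a prime number, or f = 6, or f = 9. -/
open CategoryTheory

theorem aux_new (a m : ℕ) (ha : 0 < a) (hm : Odd m) (h3 : 3 ≤ m) (hne : 1 < a ∨ 3 < m) :
    ∃ q, q.Prime ∧ q ∣ 2 ^ (a * m) + 1 ∧ ¬ q ∣ 2 ^ a + 1 := by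
  by_contra hcon
  push Not at hcon
  have hdvd : 2 ^ (a * m) + 1 ∣ (2 ^ a + 1) * m := by
    rw [← Nat.factorization_le_iff_dvd (by positivity) (by positivity)]
    intro q
    by_cases hq : q.Prime
    · by_cases hqd : q ∣ 2 ^ (a * m) + 1
      · have h1 := hcon q hq hqd
        haveI := Fact.mk hq
        have hq2 : ¬ q ∣ 2 ^ a := by
          intro h
          have := (Nat.dvd_add_right h).1 h1
          exact hq.one_lt.ne' (Nat.dvd_one.1 this)
        have hodd : Odd q := by
          refine hq.odd_of_ne_two ?_
          rintro rfl
          exact hq2 (dvd_pow_self 2 ha.ne')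
        have := padicValNat.pow_add_pow hodd h1 hq2 hm
        rw [← pow_mul, one_pow] at this
        rw [Nat.factorization_def _ hq, Nat.factorization_def _ hq, this,
          padicValNat.mul (by positivity) (by positivity)]
      · rw [Nat.factorization_eq_zero_of_not_dvd hqd]; exact Nat.zero_le _
    · rw [Nat.factorization_eq_zero_of_not_prime _ hq]; exact Nat.zero_le _
  have hle := Nat.le_of_dvd (by positivity) hdvd
  obtain ⟨n, rfl⟩ : ∃ n, m = n + 3 := ⟨m - 3, by omega⟩
  rw [pow_mul] at hle
  have hx : 2 ≤ 2 ^ a := by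
    calc 2 = 2 ^ 1 := rfl
      _ ≤ 2 ^ a := Nat.pow_le_pow_right (by norm_num) ha
  rcases hne with h | h
  · have hx : 4 ≤ 2 ^ a := by
      calc 4 = 2 ^ 2 := rfl
        _ ≤ 2 ^ a := Nat.pow_le_pow_right (by norm_num) h
    generalize 2 ^ a = x at *
    have key : ∀ n, (x + 1) * (n + 3) < x ^ (n + 3) := by
      intro n
      induction n with
      | zero =>
        have h1 : 16 ≤ x * x := Nat.mul_le_mul hx hx
        have h2 := Nat.mul_le_mul_right x h1
        have h3 : x ^ (0 + 3) = x * x * x := by ring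
        rw [h3]
        omega
      | succ k ih => 
        rw [show k + 1 + 3 = (k + 3) + 1 by ring, pow_succ]
        have h1 : x ^ (k + 3) * 2 ≤ x ^ (k + 3) * x := Nat.mul_le_mul_left _ (by omega)
        have h2 : (x + 1) * 1 ≤ (x + 1) * (k + 3) := Nat.mul_le_mul_left _ (by omega)
        rw [mul_add (x + 1) (k + 3) 1]
        omega
    have := key n
    omega
  · generalize 2 ^ a = x at *
    have key : ∀ n, (x + 1) * (n + 4) ≤ x ^ (n + 4) + 0 ∨ n = 0 := by
      intro n
      induction n with
      | zero => right; rfl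
      | succ k ih =>
        left
        rcases ih with ih | rfl
        · rw [show k + 1 + 4 = (k + 4) + 1 by ring, pow_succ]
          have h1 : x ^ (k + 4) * 2 ≤ x ^ (k + 4) * x := Nat.mul_le_mul_left _ (by omega)
          have h2 : (x + 1) * 1 ≤ (x + 1) * (k + 4) := Nat.mul_le_mul_left _ (by omega)
          rw [mul_add (x + 1) (k + 4) 1]
          omega
        · have h2 : 4 ≤ x ^ 2 := by nlinarith
          have : x ^ 5 = x ^ 2 * x ^ 2 * x := by ring
          simp only [zero_add, Nat.reduceAdd, add_zero, this]
          nlinarith [mul_le_mul h2 h2 (by norm_num) (by positivity)]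
    obtain ⟨k, rfl⟩ : ∃ k, n = k + 1 := ⟨n - 1, by omega⟩
    rcases key k with h | h
    · rw [show k + 1 + 3 = k + 4 by ring] at hle
      omega
    · subst h
      exact absurd hm (by decide)

theorem aux_card3 (n p q r : ℕ) (hn : n ≠ 0) (hp : p.Prime) (hq : q.Prime) (hr : r.Prime)
    (hpn : p ∣ n) (hqn : q ∣ n) (hrn : r ∣ n) (h1 : p ≠ q) (h2 : p ≠ r) (h3 : q ≠ r) :
    n.primeFactors.card ≠ 2 := by
  intro h
  have hs : ({p, q, r} : Finset ℕ) ⊆ n.primeFactors := by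
    intro x hx
    simp only [Finset.mem_insert, Finset.mem_singleton] at hx
    rcases hx with rfl | rfl | rfl <;> simp [*]
  have := Finset.card_le_card hs
  rw [Finset.card_eq_three.2 ⟨p, q, r, h1, h2, h3, rfl⟩] at this
  omega

theorem aux_cop (a p : ℕ) (ha : 0 < a) (hp : p.Prime) (h1 : p ∣ 2 ^ a - 1) (h2 : p ∣ 2 ^ a + 1) :
    False := by
  have h4 : 1 ≤ 2 ^ a := Nat.one_le_two_pow
  have h3 : p ∣ 2 := by
    have := Nat.dvd_sub h2 h1
    rwa [show 2 ^ a + 1 - (2 ^ a - 1) = 2 by omega] at this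
  have : p = 2 := (Nat.prime_dvd_prime_iff_eq hp Nat.prime_two).1 h3
  subst this
  have := (Nat.dvd_add_right (dvd_pow_self 2 ha.ne')).1 h2
  omega

theorem aux_fac (a : ℕ) : 2 ^ (2 * a) - 1 = (2 ^ a + 1) * (2 ^ a - 1) := by
  have := Nat.sq_sub_sq (2 ^ a) 1
  rw [← this, one_pow, ← pow_mul, mul_comm]

theorem aux_three (a : ℕ) (h : Odd a) : 3 ∣ 2 ^ a + 1 := by
  have := Odd.nat_add_dvd_pow_add_pow 2 1 h
  simpa using this

theorem stmt5 (f : ℕ) (hf : 0 < f)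
    (hm : (2 ^ f - 1).primeFactors.card = 2)
    (hp : (2 ^ f + 1).primeFactors.card = 2) :
    f.Prime ∨ f = 6 ∨ f = 9 := by
  rcases Nat.even_or_odd f with he | ho
  · obtain ⟨k, rfl⟩ := he.two_dvd
    by_cases hk1 : k = 1
    · subst hk1; left; exact Nat.prime_two
    by_cases hk3 : k = 3
    · subst hk3; right; left; rfl
    exfalso
    have hk : 2 ≤ k := by omega
    have h4 : 2 ^ 2 ≤ 2 ^ k := Nat.pow_le_pow_right (by norm_num) hk
    have hfac := aux_fac k
    have hpos : 2 ^ (2 * k) - 1 ≠ 0 := by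
      rw [hfac]; exact Nat.mul_ne_zero (by omega) (by omega)
    rcases Nat.even_or_odd k with hke | hko
    · obtain ⟨j, rfl⟩ := hke.two_dvd
      by_cases hj : j = 1
      · subst hj
        have h17 : (2 ^ (2 * (2 * 1)) + 1) = 17 := by norm_num
        rw [h17, Nat.Prime.primeFactors (by norm_num)] at hp
        simp at hp
      have h4 : 2 ^ 2 ≤ 2 ^ j := Nat.pow_le_pow_right (by norm_num) (by omega)
      have hfac2 := aux_fac j
      obtain ⟨p, hpp, hpd⟩ := Nat.exists_prime_and_dvd (n := 2 ^ j - 1) (by omega)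
      obtain ⟨q, hqq, hqd⟩ := Nat.exists_prime_and_dvd (n := 2 ^ j + 1) (by omega)
      obtain ⟨r, hrr, hrd⟩ := Nat.exists_prime_and_dvd (n := 2 ^ (2 * j) + 1) (by omega)
      have hp2 : p ∣ 2 ^ (2 * j) - 1 := hfac2 ▸ Dvd.dvd.mul_left hpd _
      have hq2 : q ∣ 2 ^ (2 * j) - 1 := hfac2 ▸ Dvd.dvd.mul_right hqd _
      refine aux_card3 _ p q r hpos hpp hqq hrr (hfac ▸ Dvd.dvd.mul_left hp2 _)
        (hfac ▸ Dvd.dvd.mul_left hq2 _) (hfac ▸ Dvd.dvd.mul_right hrd _) ?_ ?_ ?_ hm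
      · rintro rfl; exact aux_cop j p (by omega) hpp hpd hqd
      · rintro rfl; exact aux_cop (2 * j) p (by omega) hpp hp2 hrd
      · rintro rfl; exact aux_cop (2 * j) q (by omega) hqq hq2 hrd
    · have hk5 : 3 < k := by
        obtain ⟨t, ht⟩ := hko
        omega
      obtain ⟨p, hpp, hpd⟩ := Nat.exists_prime_and_dvd (n := 2 ^ k - 1) (by omega)
      obtain ⟨q, hqq, hqd, hqn⟩ := aux_new 1 k one_pos hko (by omega) (Or.inr hk5)
      rw [one_mul] at hqd
      have h3 := aux_three k hko
      refine aux_card3 _ p q 3 hpos hpp hqq Nat.prime_three (hfac ▸ Dvd.dvd.mul_left hpd _)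
        (hfac ▸ Dvd.dvd.mul_right hqd _) (hfac ▸ Dvd.dvd.mul_right h3 _) ?_ ?_ ?_ hm
      · rintro rfl; exact aux_cop k p (by omega) hpp hpd hqd
      · rintro rfl; exact aux_cop k 3 (by omega) hpp hpd h3
      · rintro rfl; exact hqn (by norm_num)
  · by_contra hcon
    push Not at hcon
    obtain ⟨hnp, -, h9⟩ := hcon
    have hf1 : f ≠ 1 := by rintro rfl; simp at hm
    obtain ⟨a, b, hab, ha, hb⟩ : ∃ a b, f = a * b ∧ 3 < a ∧ 3 ≤ b := by
      obtain ⟨a, b, ha, hb, hab⟩ := (Nat.not_prime_iff_exists_mul_eq (by omega)).1 hnp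
      subst hab
      rw [Nat.odd_mul] at ho
      obtain ⟨⟨c, rfl⟩, ⟨d, rfl⟩⟩ := ho
      have hc : c ≠ 0 := by rintro rfl; simp at hb
      have hd : d ≠ 0 := by rintro rfl; simp at ha
      by_cases h : c = 1
      · subst h
        exact ⟨2 * d + 1, 3, by ring, by omega, by omega⟩
      · exact ⟨2 * c + 1, 2 * d + 1, by ring, by omega, by omega⟩
    subst hab
    have h3 := aux_three _ ho
    rw [Nat.odd_mul] at ho
    obtain ⟨q, hqq, hqd, hqn⟩ := aux_new 1 a one_pos ho.1 (by omega) (Or.inr ha)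
    rw [one_mul] at hqd
    obtain ⟨r, hrr, hrd, hrn⟩ := aux_new a b (by omega) ho.2 hb (Or.inl (by omega))
    have hdd : 2 ^ a + 1 ∣ 2 ^ (a * b) + 1 := by
      have := Odd.nat_add_dvd_pow_add_pow (2 ^ a) 1 ho.2
      rwa [one_pow, ← pow_mul] at this
    refine aux_card3 _ 3 q r (by positivity) Nat.prime_three hqq hrr h3 (hqd.trans hdd) hrd
      ?_ ?_ ?_ hp
    · rintro rfl; exact hqn (by norm_num)
    · rintro rfl; exact hrn (aux_three a ho.1)
    · rintro rfl; exact hrn hqd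
end

section
/- Let f be a positive integer divisible by two distinct primes p₁ < p₂ with p₁p₂ ≠ 6. Then 2^f − 1 has at least three distinct prime divisors. -/
open CategoryTheory

theorem aux_ineq (p q : ℕ) (hp : 2 ≤ p) (hlt : p < q) (hq : 5 ≤ q) :
    (2 ^ p - 1) * q * ((2 ^ q - 1) * p) < 2 ^ (p * q) - 1 := by
  have key : (p = 2 ∧ q ≤ 6) ∨ p * q ≤ 2 ^ (p * q - p - q) := by
    have e1 : ∀ n : ℕ, 7 ≤ n → 2 * n ≤ 2 ^ (n - 2) := by
      intro n hn
      induction n, hn using Nat.le_induction with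
      | base => norm_num
      | succ n hn ih =>
        have : n + 1 - 2 = (n - 2) + 1 := by omega
        rw [this, pow_succ]; omega
    have e2 : ∀ n : ℕ, 4 ≤ n → n * n ≤ 2 ^ n := by
      intro n hn
      induction n, hn using Nat.le_induction with
      | base => norm_num
      | succ n hn ih => rw [pow_succ]; nlinarith
    rcases Nat.lt_or_ge 2 p with h | h
    · right
      have h1 : q ≤ p * q - p - q := by
        have : 3 * q ≤ p * q := Nat.mul_le_mul_right q h
        omega
      calc p * q ≤ q * q := Nat.mul_le_mul_right q hlt.le
        _ ≤ 2 ^ q := e2 q (by omega)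
        _ ≤ _ := Nat.pow_le_pow_right (by norm_num) h1
    · have : p = 2 := by omega
      subst this
      rcases Nat.lt_or_ge 6 q with h' | h'
      · right
        have : 2 * q - 2 - q = q - 2 := by omega
        rw [this]; exact e1 q h'
      · left; exact ⟨rfl, h'⟩
  rcases key with ⟨rfl, h⟩ | h
  · interval_cases q <;> norm_num
  · have hle : p + q ≤ p * q := by nlinarith
    have h2 : 2 ^ (p * q) = 2 ^ (p * q - p - q) * (2 ^ p * 2 ^ q) := by
      rw [← pow_add, ← pow_add]; congr 1; omega
    have hp2 : 4 ≤ 2 ^ p := Nat.pow_le_pow_right (n := 2) (by norm_num) hp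
    have hq2 : 4 ≤ 2 ^ q := Nat.pow_le_pow_right (n := 2) (i := 2) (by norm_num) (by omega)
    rw [h2]
    obtain ⟨x, hx⟩ : ∃ x, 2 ^ p = x + 1 := ⟨2 ^ p - 1, by omega⟩
    obtain ⟨y, hy⟩ : ∃ y, 2 ^ q = y + 1 := ⟨2 ^ q - 1, by omega⟩
    rw [hx, hy]
    simp only [Nat.add_sub_cancel]
    have h3 : p * q * ((x + 1) * (y + 1)) ≤ 2 ^ (p * q - p - q) * ((x + 1) * (y + 1)) :=
      Nat.mul_le_mul_right _ h
    have h4 : 1 ≤ p * q := by nlinarith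
    have h5 : x * q * (y * p) + p * q * (x + y + 1) = p * q * ((x + 1) * (y + 1)) := by ring
    have h6 : 1 * (x + y + 1) ≤ p * q * (x + y + 1) := Nat.mul_le_mul_right _ h4
    omega

theorem aux_val (a p q : ℕ) (ha : a.Prime) (hp : p ≠ 0) (hq : q ≠ 0) (h : a ∣ 2 ^ p - 1) :
    a ^ (2 ^ (p * q) - 1).factorization a ≤ (2 ^ p - 1) * q := by
  haveI := Fact.mk ha
  have hp2 : 2 ≤ 2 ^ p := by simpa using Nat.pow_le_pow_right (n := 2) (by norm_num) (Nat.one_le_iff_ne_zero.mpr hp)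
  have hev : 2 ∣ 2 ^ p := dvd_pow_self 2 hp
  have hodd : Odd a := by
    rcases ha.eq_two_or_odd' with rfl | h'
    · omega
    · exact h'
  have hn : ¬ a ∣ 2 ^ p := by
    intro h'
    have := (Nat.prime_dvd_prime_iff_eq ha Nat.prime_two).mp (ha.dvd_of_dvd_pow h')
    subst this; omega
  have := padicValNat.pow_sub_pow hodd (x := 2 ^ p) (y := 1) (by omega) h hn hq
  rw [one_pow, ← pow_mul] at this
  rw [Nat.factorization_def _ ha, this, pow_add]
  exact Nat.mul_le_mul (Nat.le_of_dvd (by omega) pow_padicValNat_dvd)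
    (Nat.le_of_dvd (by omega) pow_padicValNat_dvd)

theorem aux_main (p q : ℕ) (hp : 2 ≤ p) (hlt : p < q) (hq : 5 ≤ q) (hc : Nat.Coprime p q) :
    3 ≤ (2 ^ (p * q) - 1).primeFactors.card := by
  have h4 : ∀ n, 2 ≤ n → 4 ≤ 2 ^ n := fun n hn =>
    Nat.pow_le_pow_right (n := 2) (by norm_num) hn
  have hp4 := h4 p hp
  have hq4 := h4 q (by omega)
  have hn4 := h4 (p * q) (by nlinarith)
  obtain ⟨a, ha, hap⟩ := Nat.exists_prime_and_dvd (n := 2 ^ p - 1) (by omega)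
  obtain ⟨b, hb, hbq⟩ := Nat.exists_prime_and_dvd (n := 2 ^ q - 1) (by omega)
  have hab : a ≠ b := by
    rintro rfl
    have h1 := Nat.dvd_gcd hap hbq
    rw [Nat.pow_sub_one_gcd_pow_sub_one, hc.gcd_eq_one] at h1
    exact ha.one_lt.ne' (Nat.dvd_one.mp (by simpa using h1))
  by_contra hcon
  have hsub : ({a, b} : Finset ℕ) ⊆ (2 ^ (p * q) - 1).primeFactors := by
    intro x hx
    simp only [Finset.mem_insert, Finset.mem_singleton] at hx
    rw [Nat.mem_primeFactors]
    rcases hx with rfl | rfl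
    · exact ⟨ha, hap.trans (Nat.pow_sub_one_dvd_pow_sub_one 2 (Dvd.intro _ rfl)), by omega⟩
    · exact ⟨hb, hbq.trans (Nat.pow_sub_one_dvd_pow_sub_one 2 (Dvd.intro_left _ rfl)), by omega⟩
  have heq := Finset.eq_of_subset_of_card_le hsub (by rw [Finset.card_pair hab]; omega)
  have hN : (2 ^ (p * q) - 1).factorization.prod (fun p k => p ^ k) = 2 ^ (p * q) - 1 :=
    Nat.prod_factorization_pow_eq_self (by omega)
  rw [Finsupp.prod, Nat.support_factorization, ← heq, Finset.prod_pair hab] at hN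
  have hA := aux_val a p q ha (by omega) (by omega) hap
  have hB := aux_val b q p hb (by omega) (by omega) hbq
  rw [mul_comm q p] at hB
  have := aux_ineq p q hp hlt hq
  have := Nat.mul_le_mul hA hB
  omega

theorem stmt18 (f p₁ p₂ : ℕ) (hf : 0 < f)
    (hp₁ : p₁.Prime) (hp₂ : p₂.Prime) (hlt : p₁ < p₂)
    (hd₁ : p₁ ∣ f) (hd₂ : p₂ ∣ f) (h6 : p₁ * p₂ ≠ 6) :
    3 ≤ (2 ^ f - 1).primeFactors.card := by
  have h2 := hp₁.two_le
  have hq : 5 ≤ p₂ := by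
    have hne : p₂ ≠ 4 := by rintro rfl; norm_num at hp₂
    by_contra h
    have e1 : p₁ = 2 := by omega
    have e2 : p₂ = 3 := by omega
    subst e1 e2
    exact h6 rfl
  have hc : Nat.Coprime p₁ p₂ := (Nat.coprime_primes hp₁ hp₂).mpr hlt.ne
  refine (aux_main p₁ p₂ h2 hlt hq hc).trans (Finset.card_le_card ?_)
  refine Nat.primeFactors_mono
    (Nat.pow_sub_one_dvd_pow_sub_one 2 (hc.mul_dvd_of_dvd_of_dvd hd₁ hd₂)) ?_
  have : 2 ^ 1 ≤ 2 ^ f := Nat.pow_le_pow_right (by norm_num) hf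
  omega
end

section
/- Let p be an odd prime and n ≥ 2 an integer, and set f = pⁿ. If f ≠ 9, then 2^f + 1 has at least three distinct prime divisors. -/
open CategoryTheory

lemma size_aux (a p : ℕ) (ha : 2 ≤ a) (hp : 3 ≤ p) (h : 4 ≤ a ∨ 5 ≤ p) :
    p * (a + 1) < a ^ p + 1 := by
  have key : ∀ m, 3 ≤ m → m * (a + 1) < a ^ m + 1 → ∀ k, (m + k) * (a + 1) < a ^ (m + k) + 1 := by
    intro m hm h0 k
    induction k with
    | zero => simpa using h0
    | succ k ih =>
      have h1 : a ^ (m + (k + 1)) = a * a ^ (m + k) := by rw [← add_assoc, pow_succ, mul_comm]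
      rw [h1]
      have h2 : 2 * a ^ (m + k) ≤ a * a ^ (m + k) := Nat.mul_le_mul_right _ ha
      have h3 : 3 * (a + 1) ≤ (m + k) * (a + 1) := Nat.mul_le_mul_right _ (by omega)
      have h4 : (m + (k + 1)) * (a + 1) = (m + k) * (a + 1) + (a + 1) := by ring
      omega
  rcases h with h | h
  · obtain ⟨k, rfl⟩ := Nat.exists_eq_add_of_le hp
    exact key 3 le_rfl (by nlinarith [Nat.mul_le_mul h h, Nat.mul_le_mul_right (a * a) h, Nat.mul_le_mul_right a h]) k
  · obtain ⟨k, rfl⟩ := Nat.exists_eq_add_of_le h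
    refine key 5 (by norm_num) ?_ k
    have h1 : 2 ^ 4 ≤ a ^ 4 := Nat.pow_le_pow_left ha 4
    have h2 : a ^ 5 = a ^ 4 * a := by ring
    have h3 : 2 ^ 4 * a ≤ a ^ 4 * a := Nat.mul_le_mul_right _ h1
    omega

lemma step_aux (a p : ℕ) (hp : p.Prime) (hodd : Odd p) (ha : 2 ≤ a) (hae : Even a)
    (h : 4 ≤ a ∨ 5 ≤ p) :
    (a + 1).primeFactors.card + 1 ≤ (a ^ p + 1).primeFactors.card := by
  have hp3 : 3 ≤ p := by
    have := hp.two_le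
    obtain ⟨k, hk⟩ := hodd
    omega
  have hdvd : a + 1 ∣ a ^ p + 1 := by
    simpa using Odd.nat_add_dvd_pow_add_pow a 1 hodd
  have hsub : (a + 1).primeFactors ⊆ (a ^ p + 1).primeFactors :=
    Nat.primeFactors_mono hdvd (by positivity)
  by_contra hcon
  have heq : (a + 1).primeFactors = (a ^ p + 1).primeFactors :=
    Finset.eq_of_subset_of_card_le hsub (by omega)
  have hd : a ^ p + 1 ∣ (a + 1) * p := by
    rw [← Nat.factorization_le_iff_dvd (by positivity)
      (Nat.mul_ne_zero (by omega) hp.ne_zero)]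
    intro q
    by_cases hq : q ∈ (a ^ p + 1).primeFactors
    · rw [← heq] at hq
      have hqp := Nat.prime_of_mem_primeFactors hq
      have hqd := Nat.dvd_of_mem_primeFactors hq
      haveI : Fact q.Prime := ⟨hqp⟩
      have hqodd : Odd q := (hae.add_one).of_dvd_nat hqd
      have hqa : ¬ q ∣ a := fun h' => hqp.one_lt.ne' (Nat.dvd_one.1 ((Nat.dvd_add_right h').1 hqd))
      have := padicValNat.pow_add_pow (p := q) hqodd hqd hqa hodd
      rw [Nat.factorization_mul (by omega) hp.ne_zero]
      simp only [Finsupp.add_apply, Nat.factorization_def _ hqp]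
      simpa using this.le
    · rw [← Nat.support_factorization, Finsupp.notMem_support_iff] at hq
      omega
  have := Nat.le_of_dvd (Nat.mul_pos (by omega) hp.pos) hd
  have := size_aux a p ha hp3 h
  rw [mul_comm] at this
  omega

theorem stmt19 (p n : ℕ) (hp : p.Prime) (hodd : Odd p) (hn : 2 ≤ n)
    (h9 : p ^ n ≠ 9) :
    3 ≤ (2 ^ p ^ n + 1).primeFactors.card := by
  have ev : ∀ k, Even (2 ^ p ^ k) := fun k =>
    (even_two).pow_of_ne_zero (pow_ne_zero _ hp.ne_zero)
  have two : ∀ k, 2 ≤ 2 ^ p ^ k := fun k => by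
    simpa using Nat.pow_le_pow_right (n := 2) (by norm_num) (Nat.one_le_pow k p hp.pos)
  have four : ∀ k, 1 ≤ k → 4 ≤ 2 ^ p ^ k := fun k hk => by
    have h1 : 2 ≤ p ^ k := hp.two_le.trans (Nat.le_self_pow (by omega) p)
    simpa using Nat.pow_le_pow_right (n := 2) (by norm_num) h1
  have st : ∀ k, (1 ≤ k ∨ 5 ≤ p) →
      (2 ^ p ^ k + 1).primeFactors.card + 1 ≤ (2 ^ p ^ (k + 1) + 1).primeFactors.card := by
    intro k hk
    have := step_aux (2 ^ p ^ k) p hp hodd (two k) (ev k) (hk.imp (four k) id)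
    rwa [← pow_mul, ← pow_succ] at this
  have pos : ∀ k, 1 ≤ (2 ^ p ^ k + 1).primeFactors.card := fun k =>
    Finset.card_pos.2 (Nat.nonempty_primeFactors.2 (by have := two k; omega))
  obtain ⟨k, rfl⟩ := Nat.exists_eq_add_of_le' hn
  have h1 := st (k + 1) (Or.inl (by omega))
  by_cases h5 : 5 ≤ p
  · have h0 := st k (Or.inr h5)
    have := pos k
    rw [show k + 1 + 1 = k + 2 from rfl] at h1
    omega
  · have hp3 : p = 3 := by
      have := hp.two_le
      obtain ⟨k, hk⟩ := hodd
      omega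
    have hk : 1 ≤ k := by
      by_contra hk
      obtain rfl : k = 0 := by omega
      subst hp3
      norm_num at h9
    have h0 := st k (Or.inl hk)
    have := pos k
    rw [show k + 1 + 1 = k + 2 from rfl] at h1
    omega
end
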